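/- Let (B_s)_{s≥0} be a standard one-dimensional Brownian motion started at 0. There exist constants c₁ > 0 and C₁ > 0 such that for every t ≥ 1 and every y ∈ [0, √t], setting β := √2 − (3/(2√2))·(log t)/t + y/t and τ := inf{ s ≥ 0 : |B_s| ≥ 1 + β·s }, one has c₁·exp(−t)·exp(−√2·y) ≤ P( τ ≥ t and |B_t| ∈ [βt − 1, βt] ) ≤ C₁·exp(−t)·exp(−√2·y). (Equivalently, by the many-to-one principle, the expected number E H^R(y,t) of particles in a rate-1 binary branching reflected Brownian motion that stay below the barrier s ↦ 1 + βs up to time t and end in [βt−1, βt] satisfies c₁·e^{−√2 y} ≤ E H^R(y,t) ≤ C₁·e^{−√2 y}.) -/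

import Mathlib

open MeasureTheory ProbabilityTheory Real

/-- A standard one-dimensional Brownian motion started at `0` on a probability space
`(Ω, P)`: measurable marginals, almost surely continuous paths, `B 0 = 0`, Gaussian
increments `B t − B s ∼ N(0, t − s)` for `0 ≤ s ≤ t`, and independent increments. -/
structure IsStandardBrownianMotion {Ω : Type*} [MeasurableSpace Ω] (P : Measure Ω)
    (B : ℝ → Ω → ℝ) : Prop where
  isProbabilityMeasure : IsProbabilityMeasure P
  measurable : ∀ t : ℝ, Measurable (B t)
  cont : ∀ᵐ ω ∂P, Continuous fun s => B s ω
  init : ∀ᵐ ω ∂P, B 0 ω = 0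
  gaussian_increments : ∀ s t : ℝ, 0 ≤ s → s ≤ t →
    Measure.map (fun ω => B t ω - B s ω) P = gaussianReal 0 (Real.toNNReal (t - s))
  indep_increments : ∀ (n : ℕ) (u : Fin (n + 1) → ℝ), (∀ i, 0 ≤ u i) → Monotone u →
    iIndepFun (m := fun _ : Fin n => (inferInstance : MeasurableSpace ℝ))
      (fun i ω => B (u i.succ) ω - B (u i.castSucc) ω) P

section BM

variable {Ω : Type*} [MeasurableSpace Ω] {P : Measure Ω} {B : ℝ → Ω → ℝ}

lemma bm_indep_grid (hB : IsStandardBrownianMotion P B) (s : ℕ → ℝ) (hs : Monotone s)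
    (h0 : s 0 = 0) (m : ℕ) (t : ℝ) (ht : s m ≤ t) :
    IndepFun (fun ω (j : Fin (m + 1)) => B (s j) ω) (fun ω => B t ω - B (s m) ω) P := by
  have := hB.isProbabilityMeasure
  let u : Fin (m + 2) → ℝ := fun j => if (j : ℕ) ≤ m then s j else t
  have hs0 : ∀ j, 0 ≤ s j := fun j => h0 ▸ hs (Nat.zero_le j)
  have hu0 : ∀ j, 0 ≤ u j := by
    intro j
    by_cases h : (j : ℕ) ≤ m
    · simp [u, h, hs0]
    · simp only [u, h, if_false]
      exact (hs0 m).trans ht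
  have hum : Monotone u := by
    intro i j hij
    have hij' : (i : ℕ) ≤ j := hij
    by_cases hj : (j : ℕ) ≤ m
    · have hi : (i : ℕ) ≤ m := hij'.trans hj
      simp [u, hi, hj, hs hij']
    · by_cases hi : (i : ℕ) ≤ m
      · simp only [u, hi, hj, if_false, if_true]
        exact (hs hi).trans ht
      · simp [u, hi, hj]
  have hI := hB.indep_increments (m + 1) u hu0 hum
  have hI2 := hI.indepFun_finset (Finset.univ.filter (fun i : Fin (m + 1) => (i : ℕ) < m))
    {Fin.last m} (by
      rw [Finset.disjoint_left]
      intro a ha hb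
      simp at ha hb
      subst hb
      simp at ha) (fun i => (hB.measurable _).sub (hB.measurable _))
  let S := Finset.univ.filter (fun i : Fin (m + 1) => (i : ℕ) < m)
  let φ : (S → ℝ) → (Fin (m + 1) → ℝ) := fun x j =>
    ∑ i : S, if ((i : Fin (m + 1)) : ℕ) < j then x i else 0
  let ψ : (({Fin.last m} : Finset (Fin (m + 1))) → ℝ) → ℝ := fun x => x ⟨Fin.last m, by simp⟩
  have hφ : Measurable φ := by
    refine measurable_pi_lambda _ fun j => ?_
    refine Finset.measurable_sum _ fun i _ => ?_
    split_ifs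
    · exact measurable_pi_apply _
    · exact measurable_const
  have hψ : Measurable ψ := measurable_pi_apply _
  have hI3 := hI2.comp hφ hψ
  refine hI3.congr ?_ ?_
  · filter_upwards [hB.init] with ω hω
    funext j
    simp only [Function.comp, φ]
    rw [Finset.sum_coe_sort S (fun i : Fin (m + 1) => if (i : ℕ) < j then
      B (u i.succ) ω - B (u i.castSucc) ω else 0)]
    rw [← Finset.sum_filter]
    have hj : (j : ℕ) ≤ m := Nat.lt_succ_iff.mp j.2
    have : B (s j) ω = ∑ i ∈ Finset.range j, (B (s (i + 1)) ω - B (s i) ω) := by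
      rw [Finset.sum_range_sub (fun i => B (s i) ω), h0, hω, sub_zero]
    rw [this]
    symm
    refine Finset.sum_bij' (fun i _ => ⟨i, ?_⟩) (fun i _ => (i : ℕ)) ?_ ?_ ?_ ?_ ?_
    · rename_i a b; simp at b; omega
    · intro a ha
      simp at ha
      simp only [S, Finset.mem_filter, Finset.mem_univ, true_and]
      exact ⟨lt_of_lt_of_le ha hj, ha⟩
    · intro a ha
      simp [S] at ha
      simp; omega
    · intro a ha; rfl
    · intro a ha; rfl
    · intro a ha
      simp at ha
      have h1 : a ≤ m := by omega
      have h2 : a + 1 ≤ m := by omega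
      simp [u, h1, h2]
  · refine Filter.Eventually.of_forall fun ω => ?_
    simp [ψ, u]

lemma bm_law (hB : IsStandardBrownianMotion P B) (t : ℝ) (ht : 0 ≤ t) :
    Measure.map (B t) P = gaussianReal 0 (Real.toNNReal t) := by
  have h := hB.gaussian_increments 0 t le_rfl ht
  rw [sub_zero] at h
  rw [← h]
  refine Measure.map_congr ?_
  filter_upwards [hB.init] with ω hω
  rw [hω, sub_zero]

lemma bm_key (hB : IsStandardBrownianMotion P B) (s : ℕ → ℝ) (hs : Monotone s)
    (h0 : s 0 = 0) (m : ℕ) (t : ℝ) (ht : s m ≤ t) (S : Set (Fin (m + 1) → ℝ))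
    (hS : MeasurableSet S) (F : ℝ → ℝ) (hF : Measurable F)
    (hFint : Integrable (fun ω => F (B t ω)) P) :
    ∫ ω in {ω | (fun j : Fin (m + 1) => B (s j) ω) ∈ S}, F (B t ω) ∂P =
    ∫ ω in {ω | (fun j : Fin (m + 1) => B (s j) ω) ∈ S},
      (∫ w, F (B (s m) ω + w) ∂(gaussianReal 0 (Real.toNNReal (t - s m)))) ∂P := by
  have := hB.isProbabilityMeasure
  have hs0 : ∀ j, 0 ≤ s j := fun j => h0 ▸ hs (Nat.zero_le j)
  let X : Ω → (Fin (m + 1) → ℝ) := fun ω j => B (s j) ω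
  let N : Ω → ℝ := fun ω => B t ω - B (s m) ω
  have hX : Measurable X := measurable_pi_lambda _ fun j => hB.measurable _
  have hN : Measurable N := (hB.measurable _).sub (hB.measurable _)
  have hXN : IndepFun X N P := bm_indep_grid hB s hs h0 m t ht
  have hmap := (indepFun_iff_map_prod_eq_prod_map_map hX.aemeasurable hN.aemeasurable).1 hXN
  have hNlaw : Measure.map N P = gaussianReal 0 (Real.toNNReal (t - s m)) :=
    hB.gaussian_increments _ _ (hs0 m) ht
  rw [hNlaw] at hmap
  have hA : MeasurableSet {ω | X ω ∈ S} := hX hS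
  let G : (Fin (m + 1) → ℝ) × ℝ → ℝ := fun p =>
    S.indicator (fun x => F (x (Fin.last m) + p.2)) p.1
  have hG : Measurable G := by
    have : G = (Prod.fst ⁻¹' S).indicator (fun p : (Fin (m + 1) → ℝ) × ℝ =>
        F (p.1 (Fin.last m) + p.2)) := by
      funext p
      rfl
    rw [this]
    refine Measurable.indicator ?_ (measurable_fst hS)
    exact hF.comp (((measurable_pi_apply _).comp measurable_fst).add measurable_snd)
  have hGX : ∀ ω, G (X ω, N ω) = {ω | X ω ∈ S}.indicator (fun ω => F (B t ω)) ω := by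
    intro ω
    simp [G, X, N, Set.indicator]
  have hXNm : Measurable (fun ω => (X ω, N ω)) := hX.prodMk hN
  have hGint : Integrable G ((Measure.map X P).prod (gaussianReal 0 (Real.toNNReal (t - s m)))) := by
    rw [← hmap, integrable_map_measure hG.aestronglyMeasurable hXNm.aemeasurable]
    refine (hFint.indicator hA).congr (Filter.Eventually.of_forall fun ω => ?_)
    exact (hGX ω).symm
  change ∫ ω in {ω | X ω ∈ S}, F (B t ω) ∂P = ∫ ω in {ω | X ω ∈ S}, _ ∂P
  rw [← integral_indicator hA, ← integral_indicator hA]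
  simp_rw [← hGX]
  rw [← integral_map (φ := fun ω => (X ω, N ω)) hXNm.aemeasurable hG.aestronglyMeasurable, hmap,
    integral_prod _ hGint]
  rw [integral_map hX.aemeasurable]
  · refine integral_congr_ae (Filter.Eventually.of_forall fun ω => ?_)
    by_cases h : X ω ∈ S
    · simp [G, h, X]
    · simp [G, h]
  · exact hGint.integral_prod_left.aestronglyMeasurable

lemma bm_neg (hB : IsStandardBrownianMotion P B) :
    IsStandardBrownianMotion P (fun s ω => - B s ω) where
  isProbabilityMeasure := hB.isProbabilityMeasure
  measurable t := (hB.measurable t).neg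
  cont := by
    filter_upwards [hB.cont] with ω h
    exact h.neg
  init := by
    filter_upwards [hB.init] with ω h
    simp [h]
  gaussian_increments s t hs hst := by
    have h := hB.gaussian_increments s t hs hst
    have e : (fun ω => - B t ω - - B s ω) = (fun x => -x) ∘ (fun ω => B t ω - B s ω) := by
      funext ω; simp; ring
    have hm : Measurable (fun ω => B t ω - B s ω) := (hB.measurable _).sub (hB.measurable _)
    rw [e, ← Measure.map_map (g := fun x : ℝ => -x) measurable_neg hm, h,
      gaussianReal_map_neg, neg_zero]
  indep_increments n u hu hm := by
    have h := (hB.indep_increments n u hu hm).comp (fun _ x => -x) (fun _ => measurable_neg)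
    convert h using 2 with i
    funext ω
    simp; ring

end BM

section Gauss

/-- Centered Gaussian density of variance `R`. -/
noncomputable def gp (R m : ℝ) : ℝ := (√(2 * π * R))⁻¹ * rexp (-m ^ 2 / (2 * R))

lemma gp_nonneg (R m : ℝ) : 0 ≤ gp R m := by unfold gp; positivity

lemma gp_pos {R : ℝ} (hR : 0 < R) (m : ℝ) : 0 < gp R m := by unfold gp; positivity

lemma gp_eq (μ x : ℝ) {v : ℝ} (hv : 0 ≤ v) :
    gaussianPDFReal μ (Real.toNNReal v) x = gp v (x - μ) := by
  rw [gaussianPDFReal_def]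
  simp only [gp, Real.coe_toNNReal v hv]

lemma gp_continuous (R : ℝ) : Continuous (gp R) := by
  unfold gp
  fun_prop

lemma gp_le_one {R : ℝ} (hR : 1 ≤ R) (m : ℝ) : gp R m ≤ 1 := by
  unfold gp
  have h1 : (1 : ℝ) ≤ √(2 * π * R) := by
    rw [Real.one_le_sqrt]
    nlinarith [Real.pi_gt_three]
  have h2 : rexp (-m ^ 2 / (2 * R)) ≤ 1 := by
    rw [Real.exp_le_one_iff]
    apply div_nonpos_of_nonpos_of_nonneg
    · nlinarith [sq_nonneg m]
    · linarith
  have h3 : (√(2 * π * R))⁻¹ ≤ 1 := inv_le_one_of_one_le₀ h1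
  calc _ ≤ (1 : ℝ) * 1 := by gcongr
    _ = 1 := one_mul 1

lemma gp_conv {R r : ℝ} (hR : 0 < R) (hr : 0 ≤ r) (m : ℝ) :
    ∫ w, gp R (m - w) ∂(gaussianReal 0 (Real.toNNReal r)) = gp (R + r) m := by
  rcases hr.eq_or_lt with h | h
  · subst h
    simp [gaussianReal_zero_var]
  · rw [integral_gaussianReal_eq_integral_smul (by simpa using h)]
    have key : ∀ w, gaussianPDFReal 0 (Real.toNNReal r) w • gp R (m - w) =
        gp (R + r) m * gaussianPDFReal (m * r / (R + r)) (Real.toNNReal (R * r / (R + r))) w := by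
      intro w
      rw [gp_eq _ _ hr, gp_eq _ _ (by positivity), smul_eq_mul]
      unfold gp
      have e1 : (√(2 * π * r))⁻¹ * rexp (-(w - 0) ^ 2 / (2 * r)) *
          ((√(2 * π * R))⁻¹ * rexp (-(m - w) ^ 2 / (2 * R))) =
          (√(2 * π * r) * √(2 * π * R))⁻¹ *
            rexp (-(w - 0) ^ 2 / (2 * r) + -(m - w) ^ 2 / (2 * R)) := by
        rw [Real.exp_add, mul_inv]; ring
      have e2 : (√(2 * π * (R + r)))⁻¹ * rexp (-m ^ 2 / (2 * (R + r))) *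
          ((√(2 * π * (R * r / (R + r))))⁻¹ *
            rexp (-(w - m * r / (R + r)) ^ 2 / (2 * (R * r / (R + r))))) =
          (√(2 * π * (R + r)) * √(2 * π * (R * r / (R + r))))⁻¹ *
            rexp (-m ^ 2 / (2 * (R + r)) +
              -(w - m * r / (R + r)) ^ 2 / (2 * (R * r / (R + r)))) := by
        rw [Real.exp_add, mul_inv]; ring
      rw [e1, e2, ← Real.sqrt_mul (by positivity), ← Real.sqrt_mul (by positivity)]
      congr 1
      · congr 2
        field_simp
      · congr 1
        field_simp
        ring
    simp_rw [key]
    rw [integral_const_mul, integral_gaussianPDFReal_eq_one, mul_one]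
    have : 0 < R * r / (R + r) := by positivity
    simpa using this

lemma gp_image {r : ℝ} (hr : 0 < r) (β a z ξ : ℝ) :
    gp r (β * r + z - ξ) = rexp (2 * β * (a - z)) * gp r (β * r + 2 * a - z - ξ) *
      rexp (2 * (a - z) * (a - ξ) / r) := by
  unfold gp
  have : rexp (-(β * r + z - ξ) ^ 2 / (2 * r)) = rexp (2 * β * (a - z)) *
      rexp (-(β * r + 2 * a - z - ξ) ^ 2 / (2 * r)) * rexp (2 * (a - z) * (a - ξ) / r) := by
    rw [← Real.exp_add, ← Real.exp_add]
    congr 1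
    field_simp
    ring
  rw [this]; ring

end Gauss

section Upper

noncomputable def FU (β t x : ℝ) : ℝ :=
  gp 1 (β * (t + 1) - x) - rexp (2 * β) * gp 1 (β * (t + 1) + 2 - x)

noncomputable def UU (β t s x : ℝ) : ℝ :=
  gp (1 + (t - s)) (β * (t + 1) - x) - rexp (2 * β) * gp (1 + (t - s)) (β * (t + 1) + 2 - x)

lemma FU_continuous (β t : ℝ) : Continuous (FU β t) := by
  unfold FU
  have := gp_continuous 1
  fun_prop

lemma FU_bound (β t x : ℝ) : |FU β t x| ≤ 1 + rexp (2 * β) := by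
  unfold FU
  have h1 := gp_nonneg 1 (β * (t + 1) - x)
  have h2 := gp_le_one le_rfl (β * (t + 1) - x)
  have h3 := gp_nonneg 1 (β * (t + 1) + 2 - x)
  have h4 := gp_le_one le_rfl (β * (t + 1) + 2 - x)
  have h5 := Real.exp_pos (2 * β)
  rw [abs_le]
  constructor <;> nlinarith

lemma FU_conv (β t s x : ℝ) (hs : s ≤ t) :
    ∫ w, FU β t (x + w) ∂(gaussianReal 0 (Real.toNNReal (t - s))) = UU β t s x := by
  have hi : ∀ m, Integrable (fun w => gp 1 (m - w)) (gaussianReal 0 (Real.toNNReal (t - s))) := by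
    intro m
    refine Integrable.of_bound (C := 1) ?_ ?_
    · have := gp_continuous 1
      exact (by fun_prop : Continuous (fun w => gp 1 (m - w))).aestronglyMeasurable
    · refine Filter.Eventually.of_forall fun w => ?_
      rw [Real.norm_eq_abs, abs_of_nonneg (gp_nonneg _ _)]
      exact gp_le_one le_rfl _
  unfold FU UU
  simp_rw [← sub_sub]
  rw [integral_sub (hi _) ((hi _).const_mul _), integral_const_mul, gp_conv one_pos (by linarith),
    gp_conv one_pos (by linarith)]

lemma UU_eq (β t s x : ℝ) (hs : s ≤ t) : UU β t s x =
    rexp (2 * β) * gp (1 + (t - s)) (β * (t + 1) + 2 - x) *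
      (rexp (2 * (1 - (x - β * s)) / (1 + (t - s))) - 1) := by
  have h := gp_image (r := 1 + (t - s)) (by linarith) β 1 0 (x - β * s)
  unfold UU
  have e1 : β * (1 + (t - s)) + 0 - (x - β * s) = β * (t + 1) - x := by ring
  have e2 : β * (1 + (t - s)) + 2 * 1 - 0 - (x - β * s) = β * (t + 1) + 2 - x := by ring
  rw [e1, e2] at h
  rw [h]
  simp only [sub_zero, mul_one]
  ring

lemma UU_eq2 (β t s x : ℝ) (hs : s ≤ t) : UU β t s x =
    gp (1 + (t - s)) (β * (t + 1) - x) *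
      (1 - rexp (-(2 * (1 - (x - β * s)) / (1 + (t - s))))) := by
  have h := gp_image (r := 1 + (t - s)) (by linarith) β 1 0 (x - β * s)
  have e1 : β * (1 + (t - s)) + 0 - (x - β * s) = β * (t + 1) - x := by ring
  have e2 : β * (1 + (t - s)) + 2 * 1 - 0 - (x - β * s) = β * (t + 1) + 2 - x := by ring
  rw [e1, e2] at h
  rw [UU_eq _ _ _ _ hs, h]
  simp only [sub_zero, mul_one]
  have e3 : rexp (2 * (1 - (x - β * s)) / (1 + (t - s))) *
      rexp (-(2 * (1 - (x - β * s)) / (1 + (t - s)))) = 1 := by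
    rw [← Real.exp_add]; simp
  linear_combination (rexp (2 * β) * gp (1 + (t - s)) (β * (t + 1) + 2 - x)) * e3

lemma UU_above (β t s x : ℝ) (hs : s ≤ t) (hx : 1 + β * s ≤ x) :
    UU β t s x ≤ 0 ∧ - UU β t s x ≤ 2 * rexp (2 * β) * (x - β * s - 1) ∧
      - UU β t s x ≤ 2 * rexp (2 * β) := by
  rw [UU_eq _ _ _ _ hs]
  set R := 1 + (t - s) with hR
  have hR1 : 1 ≤ R := by linarith
  set G := gp R (β * (t + 1) + 2 - x) with hG
  have hG0 : 0 ≤ G := gp_nonneg _ _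
  have hG1 : G ≤ 1 := gp_le_one hR1 _
  set d := x - β * s - 1 with hd
  have hd0 : 0 ≤ d := by linarith
  have e : 2 * (1 - (x - β * s)) / R = - (2 * d / R) := by rw [hd]; ring
  rw [e]
  have hq : 0 ≤ 2 * d / R := by positivity
  have hq2 : 2 * d / R ≤ 2 * d := div_le_self (by positivity) hR1
  have h1 : rexp (-(2 * d / R)) ≤ 1 := by rw [Real.exp_le_one_iff]; linarith
  have h2 : 1 - rexp (-(2 * d / R)) ≤ 2 * d := by
    have := Real.add_one_le_exp (-(2 * d / R)); linarith
  have h3 : 0 < rexp (-(2 * d / R)) := Real.exp_pos _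
  set E := rexp (-(2 * d / R))
  have hb := Real.exp_pos (2 * β)
  have hw : 0 ≤ rexp (2 * β) * G := by positivity
  have hw1 : rexp (2 * β) * G ≤ rexp (2 * β) := by nlinarith
  refine ⟨by nlinarith, ?_, ?_⟩
  · calc -(rexp (2 * β) * G * (E - 1)) = rexp (2 * β) * G * (1 - E) := by ring
      _ ≤ rexp (2 * β) * (2 * d) := by
        apply mul_le_mul hw1 h2 (by linarith) hb.le
      _ = _ := by ring
  · calc -(rexp (2 * β) * G * (E - 1)) = rexp (2 * β) * G * (1 - E) := by ring
      _ ≤ rexp (2 * β) * 2 := by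
        apply mul_le_mul hw1 (by linarith) (by linarith) hb.le
      _ = _ := by ring

lemma UU_self (β t x : ℝ) : UU β t t x = FU β t x := by
  simp [UU, FU]

lemma FU_nonneg (β t x : ℝ) (hx : x ≤ 1 + β * t) : 0 ≤ FU β t x := by
  rw [← UU_self, UU_eq2 _ _ _ _ le_rfl]
  refine mul_nonneg (gp_nonneg _ _) ?_
  rw [sub_nonneg, Real.exp_le_one_iff]
  have : 0 ≤ 2 * (1 - (x - β * t)) / (1 + (t - t)) := by
    apply div_nonneg <;> linarith
  linarith

lemma FU_lower (β t x : ℝ) (hβ : 1 ≤ β) (hβ' : β ≤ 3) (h1 : β * t - 1 ≤ x) (h2 : x ≤ β * t) :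
    gp 1 4 * (1 / 2) ≤ FU β t x := by
  rw [← UU_self, UU_eq2 _ _ _ _ le_rfl]
  simp only [sub_self, add_zero, div_one]
  refine mul_le_mul ?_ ?_ (by norm_num) (gp_nonneg _ _)
  · unfold gp
    gcongr
    · nlinarith
    · nlinarith
  · have h3 : rexp (-(2 * (1 - (x - β * t)))) ≤ rexp (-1) := by
      rw [Real.exp_le_exp]; linarith
    have h4 : rexp (-1) ≤ 1 / 2 := by
      rw [Real.exp_neg, inv_eq_one_div]
      apply one_div_le_one_div_of_le (by norm_num)
      have := Real.add_one_le_exp 1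
      linarith
    linarith

lemma UU_zero (β t : ℝ) (ht : 1 ≤ t) :
    UU β t 0 0 ≤ 2 * ((t * √t)⁻¹ * rexp (-(β ^ 2 * t / 2))) := by
  rw [UU_eq2 _ _ _ _ (by linarith)]
  simp only [sub_zero, mul_zero, mul_one]
  unfold gp
  have h1 : 1 - rexp (-(2 / (1 + t))) ≤ 2 / (1 + t) := by
    have := Real.add_one_le_exp (-(2 / (1 + t))); linarith
  have h1' : 0 ≤ 1 - rexp (-(2 / (1 + t))) := by
    rw [sub_nonneg, Real.exp_le_one_iff]
    have : 0 ≤ 2 / (1 + t) := by positivity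
    linarith
  have h2 : rexp (-(β * (t + 1)) ^ 2 / (2 * (1 + t))) ≤ rexp (-(β ^ 2 * t / 2)) := by
    rw [Real.exp_le_exp]
    have : -(β * (t + 1)) ^ 2 / (2 * (1 + t)) = -(β ^ 2 * (t + 1) / 2) := by
      field_simp; ring
    rw [this]
    nlinarith [sq_nonneg β]
  have h3 : (√(2 * π * (1 + t)))⁻¹ ≤ (√t)⁻¹ := by
    apply inv_anti₀ (by positivity)
    apply Real.sqrt_le_sqrt
    nlinarith [Real.pi_gt_three]
  have h4 : 2 / (1 + t) ≤ 2 / t := by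
    apply div_le_div_of_nonneg_left <;> linarith
  calc _ ≤ (√t)⁻¹ * rexp (-(β ^ 2 * t / 2)) * (2 / t) := by
        apply mul_le_mul _ (h1.trans h4) h1' (by positivity)
        gcongr
    _ = _ := by
      rw [mul_inv]; ring

end Upper

section Grid

variable {Ω : Type*} [MeasurableSpace Ω] {P : Measure Ω} {B : ℝ → Ω → ℝ}

/-- The event that the path is in `D j` at the grid times `s j`, `j < m`. -/
def gridSet (B : ℝ → Ω → ℝ) (s : ℕ → ℝ) (D : ℕ → Set ℝ) (m : ℕ) : Set Ω :=
  {ω | ∀ j < m, B (s j) ω ∈ D j}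

lemma gridSet_measurable (hB : IsStandardBrownianMotion P B) (s : ℕ → ℝ) (D : ℕ → Set ℝ)
    (hD : ∀ j, MeasurableSet (D j)) (m : ℕ) : MeasurableSet (gridSet B s D m) := by
  have : gridSet B s D m = ⋂ j ∈ Finset.range m, B (s j) ⁻¹' (D j) := by
    ext ω; simp [gridSet]
  rw [this]
  exact Finset.measurableSet_biInter _ fun j _ => hB.measurable _ (hD j)

lemma gridSet_succ_subset (s : ℕ → ℝ) (D : ℕ → Set ℝ) (m : ℕ) :
    gridSet B s D (m + 1) ⊆ gridSet B s D m := fun _ h j hj => h j (by omega)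

lemma bm_step (hB : IsStandardBrownianMotion P B) (s : ℕ → ℝ) (hs : Monotone s)
    (h0 : s 0 = 0) (D : ℕ → Set ℝ) (hD : ∀ j, MeasurableSet (D j)) (m : ℕ) (t : ℝ) (ht : s m ≤ t)
    (F : ℝ → ℝ) (hF : Measurable F) (hFint : Integrable (fun ω => F (B t ω)) P) :
    ∫ ω in gridSet B s D (m + 1), F (B t ω) ∂P = ∫ ω in gridSet B s D m, F (B t ω) ∂P -
      ∫ ω in gridSet B s D m \ gridSet B s D (m + 1),
        (∫ w, F (B (s m) ω + w) ∂(gaussianReal 0 (Real.toNNReal (t - s m)))) ∂P := by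
  let S : Set (Fin (m + 1) → ℝ) :=
    {x | (∀ j : Fin (m + 1), (j : ℕ) < m → x j ∈ D j) ∧ x (Fin.last m) ∉ D m}
  have hS : MeasurableSet S := by
    have : S = (⋂ j : Fin (m + 1), {x | (j : ℕ) < m → x j ∈ D j}) ∩
        ((fun x : Fin (m + 1) → ℝ => x (Fin.last m)) ⁻¹' (D m))ᶜ := by
      ext x; simp [S]
    rw [this]
    have hlast : Measurable (fun x : Fin (m + 1) → ℝ => x (Fin.last m)) :=
      measurable_pi_apply _
    refine MeasurableSet.inter (MeasurableSet.iInter fun j => ?_) (hlast (hD m)).compl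
    by_cases h : (j : ℕ) < m
    · simp only [h, true_imp_iff]
      have hj : Measurable (fun x : Fin (m + 1) → ℝ => x j) := measurable_pi_apply _
      exact hj (hD j)
    · simp [h]
  have hset : gridSet B s D m \ gridSet B s D (m + 1) =
      {ω | (fun j : Fin (m + 1) => B (s j) ω) ∈ S} := by
    ext ω
    simp only [gridSet, Set.mem_sdiff, Set.mem_ofPred_eq, S, Fin.val_last]
    constructor
    · rintro ⟨h1, h2⟩
      refine ⟨fun j hj => h1 j hj, fun h => h2 fun j hj => ?_⟩
      rcases Nat.lt_succ_iff_lt_or_eq.mp hj with h' | h'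
      · exact h1 j h'
      · rw [h']; exact h
    · rintro ⟨h1, h2⟩
      exact ⟨fun j hj => h1 ⟨j, by omega⟩ hj, fun h => h2 (h m (by omega))⟩
  rw [hset, ← bm_key hB s hs h0 m t ht S hS F hF hFint, ← hset]
  rw [setIntegral_sdiff (gridSet_measurable hB s D hD (m + 1)) hFint.integrableOn
    (gridSet_succ_subset s D m)]
  ring

lemma bm_zero_int (hB : IsStandardBrownianMotion P B) (t : ℝ) (ht : 0 ≤ t)
    (F : ℝ → ℝ) (hF : Measurable F) :
    ∫ ω, F (B t ω) ∂P = ∫ w, F (0 + w) ∂(gaussianReal 0 (Real.toNNReal t)) := by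
  simp only [zero_add]
  rw [← bm_law hB t ht, integral_map (hB.measurable t).aemeasurable hF.aestronglyMeasurable]

/-- The event that some grid increment exceeds `ε`. -/
def bigStep (B : ℝ → Ω → ℝ) (t ε : ℝ) (N : ℕ) : Set Ω :=
  {ω | ∃ j < N, ε < B ((j + 1 : ℕ) * t / N) ω - B (j * t / N) ω}

lemma bigStep_measurable (hB : IsStandardBrownianMotion P B) (t ε : ℝ) (N : ℕ) :
    MeasurableSet (bigStep B t ε N) := by
  have : bigStep B t ε N = ⋃ j ∈ Finset.range N,
      {ω | ε < B ((j + 1 : ℕ) * t / N) ω - B (j * t / N) ω} := by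
    ext ω; simp [bigStep]
  rw [this]
  exact Finset.measurableSet_biUnion _ fun j _ =>
    measurableSet_lt measurable_const ((hB.measurable _).sub (hB.measurable _))

lemma bigStep_tendsto (hB : IsStandardBrownianMotion P B) (t ε : ℝ) (ht : 0 ≤ t) (hε : 0 < ε) :
    Filter.Tendsto (fun N => P.real (bigStep B t ε N)) Filter.atTop (nhds 0) := by
  have := hB.isProbabilityMeasure
  have h : Filter.Tendsto (fun N => P (bigStep B t ε N)) Filter.atTop (nhds (P ∅)) := by
    refine tendsto_measure_of_ae_tendsto_indicator_of_isFiniteMeasure Filter.atTop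
      MeasurableSet.empty (fun N => bigStep_measurable hB t ε N) ?_
    filter_upwards [hB.cont] with ω hω
    have huc := (isCompact_Icc (a := (0 : ℝ)) (b := t)).uniformContinuousOn_of_continuous
      hω.continuousOn
    rw [Metric.uniformContinuousOn_iff] at huc
    obtain ⟨δ, hδ, H⟩ := huc ε hε
    have hlim : Filter.Tendsto (fun N : ℕ => t / N) Filter.atTop (nhds 0) :=
      tendsto_const_div_atTop_nhds_zero_nat t
    filter_upwards [hlim.eventually (gt_mem_nhds hδ), Filter.eventually_gt_atTop 0] with N hN hN0
    simp only [Set.mem_empty_iff_false, iff_false]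
    rintro ⟨j, hj, hlt⟩
    have hNp : (0 : ℝ) < N := by exact_mod_cast hN0
    have hj' : (j : ℝ) + 1 ≤ N := by exact_mod_cast hj
    have hm : ∀ k : ℝ, 0 ≤ k → k ≤ N → k * t / N ∈ Set.Icc 0 t := by
      intro k hk hk2
      refine ⟨by positivity, ?_⟩
      rw [div_le_iff₀ hNp]
      nlinarith
    have := H (((j + 1 : ℕ) : ℝ) * t / N) (hm _ (by positivity) (by push_cast; exact hj'))
      (j * t / N) (hm _ (by positivity) (by linarith)) (by
        rw [Real.dist_eq]
        have : ((j + 1 : ℕ) : ℝ) * t / N - j * t / N = t / N := by push_cast; ring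
        rw [this, abs_of_nonneg (by positivity)]
        exact hN)
    rw [Real.dist_eq] at this
    have := le_abs_self (B (((j + 1 : ℕ) : ℝ) * t / N) ω - B (j * t / N) ω)
    linarith
  rw [measure_empty] at h
  have := (ENNReal.tendsto_toReal ENNReal.zero_ne_top).comp h
  simpa [Measure.real, Function.comp_def] using this

lemma upper_grid (hB : IsStandardBrownianMotion P B) (t β ε : ℝ) (ht : 1 ≤ t) (hβ : 1 ≤ β)
    (hε : 0 < ε) (N : ℕ) (hN : 0 < N) (m : ℕ) (hm : m ≤ N + 1) :
    ∫ ω in gridSet B (fun j => j * t / N) (fun j => Set.Iio (1 + β * (j * t / N))) m,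
      FU β t (B t ω) ∂P ≤ UU β t 0 0 +
      ∫ ω in (gridSet B (fun j => j * t / N) (fun j => Set.Iio (1 + β * (j * t / N))) m)ᶜ,
        2 * rexp (2 * β) * (ε + (bigStep B t ε N).indicator 1 ω) ∂P := by
  have := hB.isProbabilityMeasure
  have hNp : (0 : ℝ) < N := by exact_mod_cast hN
  set s : ℕ → ℝ := fun j => j * t / N with hsdef
  set D : ℕ → Set ℝ := fun j => Set.Iio (1 + β * (j * t / N)) with hDdef
  have hs : Monotone s := by
    intro i j hij
    have : (i : ℝ) ≤ j := by exact_mod_cast hij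
    simp only [hsdef]
    gcongr
  have h0 : s 0 = 0 := by simp [hsdef]
  have hD : ∀ j, MeasurableSet (D j) := fun j => measurableSet_Iio
  have hFm : Measurable (FU β t) := (FU_continuous β t).measurable
  have hFint : Integrable (fun ω => FU β t (B t ω)) P :=
    Integrable.of_bound (C := 1 + rexp (2 * β)) (hFm.comp (hB.measurable t)).aestronglyMeasurable
      (Filter.Eventually.of_forall fun ω => FU_bound _ _ _)
  have hA := gridSet_measurable hB s D hD
  set g : Ω → ℝ := fun ω => 2 * rexp (2 * β) * (ε + (bigStep B t ε N).indicator 1 ω) with hg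
  have hgint : Integrable g P := by
    refine Integrable.const_mul ?_ _
    refine (integrable_const ε).add ?_
    exact (integrable_const (1 : ℝ)).indicator (bigStep_measurable hB t ε N)
  induction m with
  | zero =>
    have : gridSet B s D 0 = Set.univ := by ext ω; simp [gridSet]
    rw [this]
    simp only [setIntegral_univ, Set.compl_univ, setIntegral_empty, add_zero]
    rw [bm_zero_int hB t (by linarith) _ hFm]
    have := FU_conv β t 0 0 (by linarith)
    rw [sub_zero] at this
    exact this.le
  | succ m ih =>
    have hsm : s m ≤ t := by
      have h1 : (m : ℝ) ≤ N := by exact_mod_cast (by omega : m ≤ N)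
      simp only [hsdef]
      rw [div_le_iff₀ hNp]; nlinarith
    rw [bm_step hB s hs h0 D hD m t hsm _ hFm hFint]
    simp_rw [fun x => FU_conv β t (s m) x hsm]
    have ih' := ih (by omega)
    have hdiff : (gridSet B s D (m + 1))ᶜ =
        (gridSet B s D m)ᶜ ∪ (gridSet B s D m \ gridSet B s D (m + 1)) := by
      have := gridSet_succ_subset (B := B) s D m
      ext ω
      have h2 := @this ω
      simp only [Set.mem_compl_iff, Set.mem_union, Set.mem_sdiff]
      tauto
    have hsplit : ∫ ω in (gridSet B s D (m + 1))ᶜ, g ω ∂P = ∫ ω in (gridSet B s D m)ᶜ, g ω ∂P +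
        ∫ ω in gridSet B s D m \ gridSet B s D (m + 1), g ω ∂P := by
      rw [hdiff]
      refine setIntegral_union ?_ ((hA m).diff (hA (m + 1))) hgint.integrableOn hgint.integrableOn
      rw [Set.disjoint_left]
      intro ω h1 h2
      exact h1 h2.1
    have hnew : - ∫ ω in gridSet B s D m \ gridSet B s D (m + 1), UU β t (s m) (B (s m) ω) ∂P ≤
        ∫ ω in gridSet B s D m \ gridSet B s D (m + 1), g ω ∂P := by
      rw [← integral_neg]
      have hmem : ∀ ω ∈ gridSet B s D m \ gridSet B s D (m + 1), 1 + β * s m ≤ B (s m) ω := by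
        rintro ω ⟨h1, h2⟩
        by_contra hcon
        push Not at hcon
        refine h2 fun j hj => ?_
        rcases Nat.lt_succ_iff_lt_or_eq.mp hj with h' | h'
        · exact h1 j h'
        · rw [h']; exact hcon
      refine integral_mono_of_nonneg ?_ hgint.integrableOn ?_
      · rw [Filter.EventuallyLE, ae_restrict_iff' ((hA m).diff (hA (m + 1)))]
        refine Filter.Eventually.of_forall fun ω hω => ?_
        have := (UU_above β t (s m) (B (s m) ω) hsm (hmem ω hω)).1
        simp only [Pi.zero_apply]
        linarith
      · rw [Filter.EventuallyLE, ae_restrict_iff' ((hA m).diff (hA (m + 1)))]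
        filter_upwards [hB.init] with ω hω0 hω
        have hx := hmem ω hω
        obtain ⟨-, h1, h2⟩ := UU_above β t (s m) (B (s m) ω) hsm hx
        have hexp := Real.exp_pos (2 * β)
        by_cases hbig : ω ∈ bigStep B t ε N
        · simp only [hg, Set.indicator_of_mem hbig, Pi.one_apply]
          nlinarith
        · simp only [hg, Set.indicator_of_notMem hbig, add_zero]
          refine h1.trans ?_
          gcongr
          rcases m with _ | k
          · exfalso
            rw [h0, hω0] at hx
            linarith
          · have hk : B (s k) ω < 1 + β * s k := hω.1 k (by omega)
            have hb : ¬ (ε < B (s (k + 1)) ω - B (s k) ω) := fun h =>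
              hbig ⟨k, by omega, h⟩
            push Not at hb
            have hss : s k ≤ s (k + 1) := hs (by omega)
            nlinarith
    rw [hsplit]
    linarith

lemma upper_prob (hB : IsStandardBrownianMotion P B) (t β : ℝ) (ht : 1 ≤ t) (hβ : 1 ≤ β)
    (hβ' : β ≤ 3) :
    P.real {ω | (∀ s, 0 ≤ s → s < t → B s ω < 1 + β * s) ∧ B t ω ∈ Set.Icc (β * t - 1) (β * t)} ≤
      4 / gp 1 4 * ((t * √t)⁻¹ * rexp (-(β ^ 2 * t / 2))) := by
  have := hB.isProbabilityMeasure
  set E := {ω | (∀ s, 0 ≤ s → s < t → B s ω < 1 + β * s) ∧ B t ω ∈ Set.Icc (β * t - 1) (β * t)}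
  set K := 2 * rexp (2 * β)
  have hK : 0 < K := by positivity
  set c := gp 1 4 * (1 / 2) with hc
  have hg4 := gp_pos one_pos 4
  have hc0 : 0 < c := by positivity
  have main : ∀ ε > 0, ∀ N : ℕ, 0 < N →
      c * P.real E ≤ UU β t 0 0 + K * (ε + P.real (bigStep B t ε N)) := by
    intro ε hε N hN
    have hNp : (0 : ℝ) < N := by exact_mod_cast hN
    have h := upper_grid hB t β ε ht hβ hε N hN (N + 1) le_rfl
    set s : ℕ → ℝ := fun j => j * t / N with hsdef
    set D : ℕ → Set ℝ := fun j => Set.Iio (1 + β * (j * t / N)) with hDdef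
    have hD : ∀ j, MeasurableSet (D j) := fun j => measurableSet_Iio
    have hA := gridSet_measurable hB s D hD (N + 1)
    set A := gridSet B s D (N + 1)
    have hFm : Measurable (FU β t) := (FU_continuous β t).measurable
    have hFint : Integrable (fun ω => FU β t (B t ω)) P :=
      Integrable.of_bound (C := 1 + rexp (2 * β))
        (hFm.comp (hB.measurable t)).aestronglyMeasurable
        (Filter.Eventually.of_forall fun ω => FU_bound _ _ _)
    have hb := bigStep_measurable hB t ε N
    have hgint : Integrable (fun ω => K * (ε + (bigStep B t ε N).indicator 1 ω)) P := by
      refine Integrable.const_mul ?_ _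
      refine (integrable_const ε).add ?_
      exact (integrable_const (1 : ℝ)).indicator hb
    have hle : ∫ ω in Aᶜ, K * (ε + (bigStep B t ε N).indicator 1 ω) ∂P ≤
        K * (ε + P.real (bigStep B t ε N)) := by
      refine (setIntegral_le_integral hgint (Filter.Eventually.of_forall fun ω => ?_)).trans ?_
      · have : (0 : ℝ) ≤ (bigStep B t ε N).indicator 1 ω :=
          Set.indicator_nonneg (fun _ _ => zero_le_one) _
        simp only [Pi.zero_apply]
        positivity
      · have hi1 : Integrable ((bigStep B t ε N).indicator (1 : Ω → ℝ)) P :=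
          (integrable_const (1 : ℝ)).indicator hb
        rw [integral_const_mul, integral_add (integrable_const ε) hi1,
          integral_indicator_one hb]
        simp
    have hsN : s N = t := by simp only [hsdef]; field_simp
    have hJ : MeasurableSet (A ∩ B t ⁻¹' Set.Icc (β * t - 1) (β * t)) :=
      hA.inter (hB.measurable t measurableSet_Icc)
    have hEsub : E ⊆ A ∩ B t ⁻¹' Set.Icc (β * t - 1) (β * t) := by
      rintro ω ⟨h1, h2⟩
      refine ⟨fun j hj => ?_, h2⟩
      rcases Nat.lt_succ_iff_lt_or_eq.mp hj with h' | h'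
      · refine h1 _ (by positivity) ?_
        have : (j : ℝ) < N := by exact_mod_cast h'
        simp only [hsdef]
        rw [div_lt_iff₀ hNp]; nlinarith
      · rw [h', hsN]
        change B t ω < 1 + β * (s N)
        rw [hsN]
        linarith [h2.2]
    have hlow : c * P.real (A ∩ B t ⁻¹' Set.Icc (β * t - 1) (β * t)) ≤
        ∫ ω in A, FU β t (B t ω) ∂P := by
      have h1 : ∫ ω in A ∩ B t ⁻¹' Set.Icc (β * t - 1) (β * t), FU β t (B t ω) ∂P ≤
          ∫ ω in A, FU β t (B t ω) ∂P := by
        refine setIntegral_mono_set hFint.integrableOn ?_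
          (Set.inter_subset_left.eventuallyLE)
        rw [Filter.EventuallyLE, ae_restrict_iff' hA]
        refine Filter.Eventually.of_forall fun ω hω => ?_
        refine FU_nonneg _ _ _ ?_
        have : B (s N) ω < 1 + β * s N := hω N (by omega)
        rw [hsN] at this
        exact this.le
      refine le_trans ?_ h1
      have h2 := setIntegral_mono_on (μ := P) (f := fun _ => c) (g := fun ω => FU β t (B t ω))
        (integrable_const c).integrableOn hFint.integrableOn hJ
        (fun ω hω => FU_lower β t (B t ω) hβ hβ' hω.2.1 hω.2.2)
      simpa [mul_comm] using h2
    have hmono : P.real E ≤ P.real (A ∩ B t ⁻¹' Set.Icc (β * t - 1) (β * t)) :=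
      measureReal_mono hEsub
    have := mul_le_mul_of_nonneg_left hmono hc0.le
    linarith
  have main2 : ∀ ε > 0, c * P.real E ≤ UU β t 0 0 + K * ε := by
    intro ε hε
    have hl : Filter.Tendsto (fun N => UU β t 0 0 + K * (ε + P.real (bigStep B t ε N)))
        Filter.atTop (nhds (UU β t 0 0 + K * (ε + 0))) :=
      ((((bigStep_tendsto hB t ε (by linarith) hε).const_add ε).const_mul K).const_add _)
    rw [add_zero] at hl
    refine ge_of_tendsto hl ?_
    filter_upwards [Filter.eventually_gt_atTop 0] with N hN using main ε hε N hN
  have main3 : c * P.real E ≤ UU β t 0 0 := by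
    refine le_of_forall_pos_le_add fun δ hδ => ?_
    have := main2 (δ / K) (by positivity)
    rwa [mul_div_cancel₀ _ hK.ne'] at this
  have h4 := main3.trans (UU_zero β t ht)
  have h5 : P.real E ≤ 2 * ((t * √t)⁻¹ * rexp (-(β ^ 2 * t / 2))) / c := by
    rw [le_div_iff₀ hc0]; linarith
  refine h5.trans (le_of_eq ?_)
  rw [hc]
  field_simp
  ring

end Grid

section LowerAnalytic

/-- Kernel killed at the line with intercept `3/4`. -/
noncomputable def qk (r β ξ z : ℝ) : ℝ :=
  gp r (β * r + z - ξ) - rexp (2 * β * (3 / 4 - z)) * gp r (β * r + 2 * (3 / 4) - z - ξ)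

lemma qk_eq {r : ℝ} (hr : 0 < r) (β ξ z : ℝ) : qk r β ξ z =
    gp r (β * r + z - ξ) * (1 - rexp (-(2 * (3 / 4 - z) * (3 / 4 - ξ) / r))) := by
  have h := gp_image hr β (3 / 4) z ξ
  have e3 : rexp (2 * (3 / 4 - z) * (3 / 4 - ξ) / r) *
      rexp (-(2 * (3 / 4 - z) * (3 / 4 - ξ) / r)) = 1 := by
    rw [← Real.exp_add]; simp
  unfold qk
  linear_combination (rexp (-(2 * (3 / 4 - z) * (3 / 4 - ξ) / r))) * h +
    (rexp (2 * β * (3 / 4 - z)) * gp r (β * r + 2 * (3 / 4) - z - ξ)) * e3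

lemma qk_continuous (r β ξ : ℝ) : Continuous (qk r β ξ) := by
  unfold qk
  have := gp_continuous r
  fun_prop

lemma one_sub_exp_le {w w' : ℝ} (hw : 0 < w) (hww : w ≤ w') :
    1 - rexp (-w') ≤ w' / w * (1 - rexp (-w)) := by
  have h := one_add_mul_self_le_rpow_one_add (s := rexp (-w) - 1)
    (by linarith [Real.exp_pos (-w)]) (p := w' / w) (by rwa [one_le_div hw])
  have e : (1 + (rexp (-w) - 1)) ^ (w' / w) = rexp (-w') := by
    rw [add_sub_cancel, ← Real.exp_mul]
    congr 1
    field_simp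
  rw [e] at h
  linarith

lemma sqrt_ratio {s r : ℝ} (hr : 0 < r) (hs : 0 ≤ s) :
    √((s + r) / r) * ((s + r) / r) ≤ rexp (3 / 2 * (s / r)) := by
  have h1 : (s + r) / r ≤ rexp (s / r) := by
    have := Real.add_one_le_exp (s / r)
    have e : (s + r) / r = s / r + 1 := by field_simp
    rw [e]; exact this
  have h2 : √((s + r) / r) ≤ rexp (s / r / 2) := by
    rw [Real.exp_half]
    exact Real.sqrt_le_sqrt h1
  calc _ ≤ rexp (s / r / 2) * rexp (s / r) := by
        apply mul_le_mul h2 h1 (by positivity) (Real.exp_pos _).le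
    _ = _ := by rw [← Real.exp_add]; congr 1; ring

lemma qk_hexp (r β s ξ z d : ℝ) (hr0 : 0 < r) (ht : 1 ≤ s + r) (hβ : 1 ≤ β) (hs : 0 ≤ s)
    (hd0 : 0 ≤ d) (hξd : ξ = -(3 / 4 + 2 * β * s) - d) (hz : -(1 / 4) ≤ z) :
    3 / 2 * (s / r) + ((β * s + d / 2) / 2 + 11 / 8) +
        -(β * r + z - ξ) ^ 2 / (2 * r) ≤
        -(β * (s + r) + z - 0) ^ 2 / (2 * (s + r)) +
          (-(β * (ξ + β * s)) - β ^ 2 * s / 2) := by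
  have hβs : 0 ≤ β * s := by positivity
  have ht0 : 0 < s + r := by linarith
  have hA : -(β * r + z - ξ) ^ 2 / (2 * r) =
      -(β ^ 2 * r / 2) - β * (z - ξ) - (z - ξ) ^ 2 / (2 * r) := by field_simp; ring
  have hBB : -(β * (s + r) + z - 0) ^ 2 / (2 * (s + r)) =
      -(β ^ 2 * (s + r) / 2) - β * z - z ^ 2 / (2 * (s + r)) := by field_simp; ring
  have hC : z ^ 2 / (2 * (s + r)) ≤ z ^ 2 / (2 * r) := by
    apply div_le_div_of_nonneg_left (sq_nonneg z) (by linarith) (by linarith)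
  have hD : (2 * (β * s)) ^ 2 / (2 * r) + z ^ 2 / (2 * r) ≤ (z - ξ) ^ 2 / (2 * r) := by
    rw [← add_div]
    apply div_le_div_of_nonneg_right _ (by linarith)
    have e : z - ξ = 2 * (β * s) + (z + 3 / 4 + d) := by rw [hξd]; ring
    rw [e]
    have : 0 ≤ z + 3 / 4 + d := by linarith
    nlinarith [mul_nonneg hβs this]
  have hE : 3 / 2 * (s / r) - (2 * (β * s)) ^ 2 / (2 * r) - 2 * β ^ 2 * s + β * s / 2 ≤ 0 := by
    have e : 3 / 2 * (s / r) - (2 * (β * s)) ^ 2 / (2 * r) - 2 * β ^ 2 * s + β * s / 2 =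
        s * (3 / 2 - 2 * β ^ 2 * (s + r) + β * r / 2) / r := by field_simp; ring
    rw [e]
    apply div_nonpos_of_nonpos_of_nonneg _ hr0.le
    apply mul_nonpos_of_nonneg_of_nonpos hs
    have h6 : 1 ≤ β ^ 2 := by nlinarith
    have h7 : β ≤ β ^ 2 := by nlinarith
    have h8 : β * r ≤ β ^ 2 * (s + r) := by
      apply mul_le_mul h7 (by linarith) hr0.le (by positivity)
    have h9 : 1 ≤ β ^ 2 * (s + r) := one_le_mul_of_one_le_of_one_le h6 ht
    linarith
  rw [hA, hBB]
  have hξ2 : β * ξ = -(3 / 4 * β) - 2 * β ^ 2 * s - β * d := by rw [hξd]; ring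
  have hdd : d ≤ β * d := by nlinarith
  have e1 : β * (ξ + β * s) = β * ξ + β ^ 2 * s := by ring
  have e2 : β * (z - ξ) = β * z - β * ξ := by ring
  rw [e1, e2, hξ2]
  linarith

lemma qk_key (t β s ξ z : ℝ) (ht : 1 ≤ t) (hβ : 1 ≤ β) (hs : 0 ≤ s) (hst : s < t)
    (hξ : ξ ≤ -(3 / 4 + 2 * β * s)) (hz : -(1 / 4) ≤ z) (hz0 : z ≤ 0) :
    qk (t - s) β ξ z ≤ 3 / 4 * qk t β 0 z * rexp (-(β * (ξ + β * s)) - β ^ 2 * s / 2) := by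
  obtain ⟨r, hr⟩ : ∃ r, r = t - s := ⟨_, rfl⟩
  obtain rfl : t = s + r := by linarith
  have hr0 : 0 < r := by linarith
  have ht0 : 0 < s + r := by linarith
  have hr' : s + r - s = r := by ring
  rw [hr', qk_eq hr0, qk_eq ht0]
  obtain ⟨d, hd⟩ : ∃ d, d = -(3 / 4 + 2 * β * s) - ξ := ⟨_, rfl⟩
  have hd0 : 0 ≤ d := by linarith
  obtain rfl : ξ = -(3 / 4 + 2 * β * s) - d := by linarith
  set ξ := -(3 / 4 + 2 * β * s) - d with hξd
  have hβs : 0 ≤ β * s := by positivity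
  set w' := 2 * (3 / 4 - z) * (3 / 4 - ξ) / r with hw'
  set w := 2 * (3 / 4 - z) * (3 / 4 - 0) / (s + r) with hw
  have hw0 : 0 < w := by
    rw [hw]; apply div_pos _ ht0; nlinarith
  have hww : w ≤ w' := by
    rw [hw, hw']
    have hzz : 0 ≤ 3 / 4 - z := by linarith
    apply div_le_div₀ _ _ hr0 (by linarith)
    · apply mul_nonneg (by positivity); linarith
    · apply mul_le_mul_of_nonneg_left _ (by positivity)
      linarith
  have h1 := one_sub_exp_le hw0 hww
  have hratio : w' / w = (2 + (4 / 3) * (2 * (β * s) + d)) * ((s + r) / r) := by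
    rw [hw, hw', hξd]
    have hzz : (3 / 4 - z) ≠ 0 := by linarith
    generalize 3 / 4 - z = c at hzz
    field_simp
    ring
  have hP : 0 ≤ 1 - rexp (-w) := by
    rw [sub_nonneg, Real.exp_le_one_iff]; linarith
  -- main numeric inequality
  have hnum : gp r (β * r + z - ξ) * (w' / w) ≤
      3 / 4 * gp (s + r) (β * (s + r) + z - 0) *
        rexp (-(β * (ξ + β * s)) - β ^ 2 * s / 2) := by
    rw [hratio]
    unfold gp
    have hsq : (√(2 * π * r))⁻¹ = (√(2 * π * (s + r)))⁻¹ * √((s + r) / r) := by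
      have : 2 * π * (s + r) = (2 * π * r) * ((s + r) / r) := by field_simp
      rw [this, Real.sqrt_mul (by positivity : (0:ℝ) ≤ 2 * π * r)]
      have hne : √((s + r) / r) ≠ 0 := by positivity
      rw [mul_inv, inv_mul_cancel_right₀ hne]
    have hlin : 2 + (4 / 3) * (2 * (β * s) + d) ≤
        3 / 4 * rexp ((β * s + d / 2) / 2 + 11 / 8) := by
      have h2 := Real.add_one_le_exp ((β * s + d / 2) / 2 - 5 / 8)
      have h3 : rexp ((β * s + d / 2) / 2 + 11 / 8) =
          rexp ((β * s + d / 2) / 2 - 5 / 8) * rexp 2 := by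
        rw [← Real.exp_add]; congr 1; ring
      have h4 : (64 / 9 : ℝ) ≤ rexp 2 := by
        have := Real.exp_one_gt_d9
        have e : rexp 2 = rexp 1 * rexp 1 := by rw [← Real.exp_add]; norm_num
        rw [e]; nlinarith
      rw [h3]
      have h5 : ((β * s + d / 2) / 2 - 5 / 8 + 1) * (64 / 9) ≤
          rexp ((β * s + d / 2) / 2 - 5 / 8) * rexp 2 := by
        apply mul_le_mul h2 h4 (by norm_num) (Real.exp_pos _).le
      linarith
    have hexp := qk_hexp r β s ξ z d hr0 ht hβ hs hd0 hξd hz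
    rw [hsq]
    calc (√(2 * π * (s + r)))⁻¹ * √((s + r) / r) * rexp (-(β * r + z - ξ) ^ 2 / (2 * r)) *
          ((2 + (4 / 3) * (2 * (β * s) + d)) * ((s + r) / r))
        = (√(2 * π * (s + r)))⁻¹ * ((√((s + r) / r) * ((s + r) / r)) *
          (2 + (4 / 3) * (2 * (β * s) + d)) * rexp (-(β * r + z - ξ) ^ 2 / (2 * r))) := by ring
      _ ≤ (√(2 * π * (s + r)))⁻¹ * (rexp (3 / 2 * (s / r)) *
          (3 / 4 * rexp ((β * s + d / 2) / 2 + 11 / 8)) *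
            rexp (-(β * r + z - ξ) ^ 2 / (2 * r))) := by
        have := sqrt_ratio hr0 hs
        gcongr
      _ = (√(2 * π * (s + r)))⁻¹ * (3 / 4 * rexp (3 / 2 * (s / r) +
          ((β * s + d / 2) / 2 + 11 / 8) + -(β * r + z - ξ) ^ 2 / (2 * r))) := by
        rw [Real.exp_add (3 / 2 * (s / r) + ((β * s + d / 2) / 2 + 11 / 8)),
          Real.exp_add (3 / 2 * (s / r))]; ring
      _ ≤ (√(2 * π * (s + r)))⁻¹ * (3 / 4 * rexp (-(β * (s + r) + z - 0) ^ 2 / (2 * (s + r)) +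
          (-(β * (ξ + β * s)) - β ^ 2 * s / 2))) := by
        gcongr
      _ = _ := by
        rw [Real.exp_add]; ring
  calc gp r (β * r + z - ξ) * (1 - rexp (-w'))
      ≤ gp r (β * r + z - ξ) * (w' / w * (1 - rexp (-w))) := by
        apply mul_le_mul_of_nonneg_left h1 (gp_nonneg _ _)
    _ = gp r (β * r + z - ξ) * (w' / w) * (1 - rexp (-w)) := by ring
    _ ≤ _ := mul_le_mul_of_nonneg_right hnum hP
    _ = _ := by ring

lemma qk_lower (t β z : ℝ) (ht : 1 ≤ t) (hβ : 1 ≤ β) (hz : -(1 / 4) ≤ z) (hz0 : z ≤ 0) :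
    (√(2 * π))⁻¹ * rexp (-1) / 2 * ((t * √t)⁻¹ * rexp (-(β ^ 2 * t / 2))) ≤ qk t β 0 z := by
  have ht0 : 0 < t := by linarith
  rw [qk_eq ht0]
  unfold gp
  have h1 : 1 / (2 * t) ≤ 1 - rexp (-(2 * (3 / 4 - z) * (3 / 4 - 0) / t)) := by
    have h2 : rexp (-(2 * (3 / 4 - z) * (3 / 4 - 0) / t)) ≤ rexp (-(1 / t)) := by
      rw [Real.exp_le_exp, neg_le_neg_iff]
      apply div_le_div_of_nonneg_right _ ht0.le
      linarith
    have h3 : rexp (-(1 / t)) ≤ t / (t + 1) := by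
      rw [Real.exp_neg]
      have h4 := Real.add_one_le_exp (1 / t)
      have e : t / (t + 1) = (1 / t + 1)⁻¹ := by field_simp; ring
      rw [e]
      apply inv_anti₀ (by positivity) h4
    have h5 : t / (t + 1) + 1 / (2 * t) ≤ 1 := by
      rw [div_add_div _ _ (by positivity) (by positivity), div_le_one (by positivity)]
      nlinarith
    linarith
  have h6 : rexp (-1) * rexp (-(β ^ 2 * t / 2)) ≤
      rexp (-(β * t + z - 0) ^ 2 / (2 * t)) := by
    rw [← Real.exp_add, Real.exp_le_exp]
    have hBB : -(β * t + z - 0) ^ 2 / (2 * t) =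
          -(β ^ 2 * t / 2) - β * z - z ^ 2 / (2 * t) := by field_simp; ring
    rw [hBB]
    have h7 : z ^ 2 / (2 * t) ≤ 1 := by
      rw [div_le_one (by positivity)]; nlinarith
    nlinarith
  rw [Real.sqrt_mul (by positivity : (0:ℝ) ≤ 2 * π) t]
  have hq0 : 0 < √(2 * π) := by positivity
  generalize √(2 * π) = q at hq0 ⊢
  calc _ = (q * √t)⁻¹ * (rexp (-1) * rexp (-(β ^ 2 * t / 2))) * (1 / (2 * t)) := by
        rw [mul_inv, mul_inv]; field_simp
    _ ≤ _ := by
      apply mul_le_mul _ h1 (by positivity) (by positivity)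
      apply mul_le_mul_of_nonneg_left h6 (by positivity)

/-- Terminal function for the lower bound (before correction). -/
noncomputable def fL (β t x : ℝ) : ℝ :=
  (Set.Icc (-(1 / 4) : ℝ) 0).indicator (fun _ => 1) (x - β * t) -
  (Set.Icc (-(1 / 4) : ℝ) 0).indicator (fun z => rexp (2 * β * (3 / 4 - z)))
    (2 * (3 / 4) - (x - β * t))

lemma fL_measurable (β t : ℝ) : Measurable (fL β t) := by
  unfold fL
  refine Measurable.sub ?_ ?_
  · exact (measurable_const.indicator measurableSet_Icc).comp (by fun_prop)
  · exact ((by fun_prop : Measurable (fun z => rexp (2 * β * (3 / 4 - z)))).indicator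
      measurableSet_Icc).comp (by fun_prop)

lemma fL_bound (β t x : ℝ) (hβ : 0 ≤ β) : |fL β t x| ≤ 1 + rexp (2 * β) := by
  unfold fL
  have h1 : 0 ≤ (Set.Icc (-(1 / 4) : ℝ) 0).indicator (fun _ => (1 : ℝ)) (x - β * t) :=
    Set.indicator_nonneg (fun _ _ => zero_le_one) _
  have h2 : (Set.Icc (-(1 / 4) : ℝ) 0).indicator (fun _ => (1 : ℝ)) (x - β * t) ≤ 1 :=
    Set.indicator_le_self' (fun _ _ => zero_le_one) _
  have h3 : 0 ≤ (Set.Icc (-(1 / 4) : ℝ) 0).indicator (fun z => rexp (2 * β * (3 / 4 - z)))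
      (2 * (3 / 4) - (x - β * t)) :=
    Set.indicator_nonneg (fun _ _ => (Real.exp_pos _).le) _
  have h4 : (Set.Icc (-(1 / 4) : ℝ) 0).indicator (fun z => rexp (2 * β * (3 / 4 - z)))
      (2 * (3 / 4) - (x - β * t)) ≤ rexp (2 * β) := by
    by_cases h : (2 * (3 / 4) - (x - β * t)) ∈ Set.Icc (-(1 / 4) : ℝ) 0
    · rw [Set.indicator_of_mem h, Real.exp_le_exp]
      have := h.1
      nlinarith
    · rw [Set.indicator_of_notMem h]; exact (Real.exp_pos _).le
  rw [abs_le]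
  constructor <;> linarith [Real.exp_pos (2 * β)]

lemma fL_conv (β t s x : ℝ) (hs : s < t) :
    ∫ w, fL β t (x + w) ∂(gaussianReal 0 (Real.toNNReal (t - s))) =
      ∫ z in Set.Icc (-(1 / 4) : ℝ) 0, qk (t - s) β (x - β * s) z := by
  have hr : 0 < t - s := by linarith
  set r := t - s with hrdef
  set J := Set.Icc (-(1 / 4) : ℝ) 0 with hJ
  have hJm : MeasurableSet J := measurableSet_Icc
  have hgc := gp_continuous r
  rw [integral_gaussianReal_eq_integral_smul (by simpa using hr)]
  set g1 : ℝ → ℝ := J.indicator (fun z => gp r (β * r + z - (x - β * s))) with hg1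
  set g2 : ℝ → ℝ := J.indicator (fun z => rexp (2 * β * (3 / 4 - z)) *
    gp r (β * r + 2 * (3 / 4) - z - (x - β * s))) with hg2
  have hi : ∀ f : ℝ → ℝ, Continuous f → Integrable (J.indicator f) volume := by
    intro f hf
    rw [integrable_indicator_iff hJm]
    exact hf.continuousOn.integrableOn_compact isCompact_Icc
  have hg1i : Integrable g1 := hi _ (by fun_prop)
  have hg2i : Integrable g2 := hi _ (by fun_prop)
  have key : ∀ w, gaussianPDFReal 0 (Real.toNNReal r) w • fL β t (x + w) =
      g1 (w + (x - β * t)) - g2 ((2 * (3 / 4) - (x - β * t)) - w) := by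
    intro w
    rw [gp_eq _ _ hr.le, smul_eq_mul]
    unfold fL
    have e1 : x + w - β * t = w + (x - β * t) := by ring
    have e2 : 2 * (3 / 4) - (x + w - β * t) = (2 * (3 / 4) - (x - β * t)) - w := by ring
    rw [e2, e1, mul_sub]
    congr 1
    · by_cases h : w + (x - β * t) ∈ J
      · rw [hg1, Set.indicator_of_mem h, Set.indicator_of_mem h, mul_one]
        congr 1
        rw [hrdef]; ring
      · rw [hg1, Set.indicator_of_notMem h, Set.indicator_of_notMem h, mul_zero]
    · by_cases h : (2 * (3 / 4) - (x - β * t)) - w ∈ J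
      · rw [hg2, Set.indicator_of_mem h, Set.indicator_of_mem h, mul_comm]
        congr 2
        rw [hrdef]; ring
      · rw [hg2, Set.indicator_of_notMem h, Set.indicator_of_notMem h, mul_zero]
  simp_rw [key]
  rw [integral_sub (hg1i.comp_add_right _) (hg2i.comp_sub_left _),
    integral_add_right_eq_self g1, integral_sub_left_eq_self g2, ← integral_sub hg1i hg2i,
    ← integral_indicator hJm]
  congr 1
  funext z
  by_cases h : z ∈ J
  · simp [hg1, hg2, h, qk]
  · simp [hg1, hg2, h]

/-- The value of the killed problem at the starting point. -/
noncomputable def uL (β t : ℝ) : ℝ := ∫ z in Set.Icc (-(1 / 4) : ℝ) 0, qk t β 0 z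

lemma uL_lower (t β : ℝ) (ht : 1 ≤ t) (hβ : 1 ≤ β) :
    (√(2 * π))⁻¹ * rexp (-1) / 8 * ((t * √t)⁻¹ * rexp (-(β ^ 2 * t / 2))) ≤ uL β t := by
  have h := setIntegral_mono_on (μ := volume) (s := Set.Icc (-(1 / 4) : ℝ) 0)
    (f := fun _ => (√(2 * π))⁻¹ * rexp (-1) / 2 * ((t * √t)⁻¹ * rexp (-(β ^ 2 * t / 2))))
    (g := fun z => qk t β 0 z) (continuous_const.continuousOn.integrableOn_compact isCompact_Icc)
    ((qk_continuous t β 0).continuousOn.integrableOn_compact isCompact_Icc) measurableSet_Icc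
    (fun z hz => qk_lower t β z ht hβ hz.1 hz.2)
  refine le_trans (le_of_eq ?_) h
  rw [setIntegral_const]
  simp
  ring

lemma uL_nonneg (t β : ℝ) (ht : 1 ≤ t) (hβ : 1 ≤ β) : 0 ≤ uL β t :=
  le_trans (by positivity) (uL_lower t β ht hβ)

noncomputable def FL (β t x : ℝ) : ℝ :=
  fL β t x - 3 / 4 * uL β t * rexp (-(β ^ 2 * t / 2)) * rexp (-β * x)

lemma FL_measurable (β t : ℝ) : Measurable (FL β t) := by
  unfold FL
  have := fL_measurable β t
  fun_prop

lemma FL_conv (β t s x : ℝ) (hs : s ≤ t) (hβ : 0 ≤ β) :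
    ∫ w, FL β t (x + w) ∂(gaussianReal 0 (Real.toNNReal (t - s))) =
    ∫ w, fL β t (x + w) ∂(gaussianReal 0 (Real.toNNReal (t - s))) -
      3 / 4 * uL β t * rexp (-(β * x) - β ^ 2 * s / 2) := by
  unfold FL
  have e : ∀ w, 3 / 4 * uL β t * rexp (-(β ^ 2 * t / 2)) * rexp (-β * (x + w)) =
      3 / 4 * uL β t * rexp (-(β ^ 2 * t / 2)) * rexp (-β * x) * rexp (-β * w) := by
    intro w
    rw [mul_add, Real.exp_add]; ring
  simp_rw [e]
  rw [integral_sub, integral_const_mul]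
  · congr 1
    have h := congrFun (mgf_id_gaussianReal (μ := 0) (v := Real.toNNReal (t - s))) (-β)
    simp only [mgf, id] at h
    rw [h, mul_assoc, mul_assoc, ← Real.exp_add, ← Real.exp_add,
      Real.coe_toNNReal _ (by linarith)]
    congr 2
    ring
  · refine Integrable.of_bound (C := 1 + rexp (2 * β)) ?_ ?_
    · exact ((fL_measurable β t).comp (measurable_const_add x)).aestronglyMeasurable
    · exact Filter.Eventually.of_forall fun w => fL_bound β t _ hβ
  · exact (integrable_exp_mul_gaussianReal _).const_mul _

lemma FL_outside (β t s x : ℝ) (ht : 1 ≤ t) (hβ : 1 ≤ β) (hs : 0 ≤ s) (hst : s ≤ t)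
    (hx : 3 / 4 + β * s < |x|) :
    ∫ w, FL β t (x + w) ∂(gaussianReal 0 (Real.toNNReal (t - s))) ≤ 0 := by
  rw [FL_conv β t s x hst (by linarith)]
  have hu := uL_nonneg t β ht hβ
  have hβs : 0 ≤ β * s := by positivity
  have hv : 0 ≤ 3 / 4 * uL β t * rexp (-(β * x) - β ^ 2 * s / 2) := by positivity
  rcases hst.eq_or_lt with h | h
  · subst h
    rw [sub_self, Real.toNNReal_zero, gaussianReal_zero_var, integral_dirac, add_zero]
    have hf : fL β s x ≤ 0 := by
      unfold fL
      have h3 : 0 ≤ (Set.Icc (-(1 / 4) : ℝ) 0).indicator (fun z => rexp (2 * β * (3 / 4 - z)))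
          (2 * (3 / 4) - (x - β * s)) :=
        Set.indicator_nonneg (fun _ _ => (Real.exp_pos _).le) _
      rw [Set.indicator_of_notMem]
      · linarith
      · rintro ⟨h1, h2⟩
        rcases lt_abs.mp hx with h4 | h4 <;> linarith
    linarith
  · rw [fL_conv β t s x h]
    have hr : 0 < t - s := by linarith
    rcases lt_abs.mp hx with h4 | h4
    · have : ∫ z in Set.Icc (-(1 / 4) : ℝ) 0, qk (t - s) β (x - β * s) z ≤ 0 := by
        refine setIntegral_nonpos measurableSet_Icc fun z hz => ?_
        rw [qk_eq hr]
        refine mul_nonpos_of_nonneg_of_nonpos (gp_nonneg _ _) ?_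
        rw [sub_nonpos, Real.one_le_exp_iff, neg_nonneg]
        apply div_nonpos_of_nonpos_of_nonneg _ hr.le
        have := hz.2
        apply mul_nonpos_of_nonneg_of_nonpos <;> linarith
      linarith
    · have hm := setIntegral_mono_on (μ := volume) (s := Set.Icc (-(1 / 4) : ℝ) 0)
        (f := fun z => qk (t - s) β (x - β * s) z)
        (g := fun z => qk t β 0 z * (3 / 4 * rexp (-(β * x) - β ^ 2 * s / 2)))
        ((qk_continuous _ β _).continuousOn.integrableOn_compact isCompact_Icc)
        (((qk_continuous _ β _).mul continuous_const).continuousOn.integrableOn_compact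
          isCompact_Icc) measurableSet_Icc
        (fun z hz => by
          have := qk_key t β s (x - β * s) z ht hβ hs h (by linarith) hz.1 hz.2
          rw [sub_add_cancel] at this
          linarith)
      rw [integral_mul_const] at hm
      unfold uL
      linarith

end LowerAnalytic

section LowerProb

variable {Ω : Type*} [MeasurableSpace Ω] {P : Measure Ω} {B : ℝ → Ω → ℝ}

lemma FL_le (β t x : ℝ) (ht : 1 ≤ t) (hβ : 1 ≤ β) :
    FL β t x ≤ (Set.Icc (-(1 / 4) : ℝ) 0).indicator (fun _ => 1) (x - β * t) := by
  have hu := uL_nonneg t β ht hβ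
  unfold FL fL
  have h3 : 0 ≤ (Set.Icc (-(1 / 4) : ℝ) 0).indicator (fun z => rexp (2 * β * (3 / 4 - z)))
      (2 * (3 / 4) - (x - β * t)) :=
    Set.indicator_nonneg (fun _ _ => (Real.exp_pos _).le) _
  have h4 : 0 ≤ 3 / 4 * uL β t * rexp (-(β ^ 2 * t / 2)) * rexp (-β * x) := by positivity
  linarith

lemma FL_integrable (hB : IsStandardBrownianMotion P B) (t β : ℝ) (ht : 0 ≤ t) (hβ : 0 ≤ β) :
    Integrable (fun ω => FL β t (B t ω)) P := by
  have hi : Integrable (FL β t) (Measure.map (B t) P) := by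
    rw [bm_law hB t ht]
    unfold FL
    refine Integrable.sub ?_ ?_
    · refine Integrable.of_bound (C := 1 + rexp (2 * β)) ?_ ?_
      · exact (fL_measurable β t).aestronglyMeasurable
      · exact Filter.Eventually.of_forall fun w => fL_bound β t _ hβ
    · exact (integrable_exp_mul_gaussianReal _).const_mul _
  exact hi.comp_measurable (hB.measurable t)

lemma lower_grid (hB : IsStandardBrownianMotion P B) (t β : ℝ) (ht : 1 ≤ t) (hβ : 1 ≤ β)
    (N : ℕ) (hN : 0 < N) (m : ℕ) (hm : m ≤ N + 1) :
    uL β t / 4 ≤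
    ∫ ω in gridSet B (fun j => j * t / N) (fun j => {x | |x| ≤ 3 / 4 + β * (j * t / N)}) m,
      FL β t (B t ω) ∂P := by
  have := hB.isProbabilityMeasure
  have hNp : (0 : ℝ) < N := by exact_mod_cast hN
  set s : ℕ → ℝ := fun j => j * t / N with hsdef
  set D : ℕ → Set ℝ := fun j => {x | |x| ≤ 3 / 4 + β * (j * t / N)} with hDdef
  have hs : Monotone s := by
    intro i j hij
    have : (i : ℝ) ≤ j := by exact_mod_cast hij
    simp only [hsdef]
    gcongr
  have h0 : s 0 = 0 := by simp [hsdef]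
  have hD : ∀ j, MeasurableSet (D j) := fun j =>
    measurableSet_le measurable_id.abs measurable_const
  have hFint := FL_integrable hB t β (by linarith) (by linarith)
  induction m with
  | zero =>
    have e : gridSet B s D 0 = Set.univ := by ext ω; simp [gridSet]
    rw [e, setIntegral_univ, bm_zero_int hB t (by linarith) _ (FL_measurable β t)]
    have h := FL_conv β t 0 0 (by linarith) (by linarith)
    rw [fL_conv β t 0 0 (by linarith)] at h
    simp only [sub_zero, mul_zero, zero_div, neg_zero, Real.exp_zero, mul_one] at h
    rw [h]
    have : ∫ z in Set.Icc (-(1 / 4) : ℝ) 0, qk t β 0 z = uL β t := rfl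
    rw [this]
    linarith
  | succ m ih =>
    have hmN : m ≤ N := by omega
    have hmt : s m ≤ t := by
      have : (m : ℝ) ≤ N := by exact_mod_cast hmN
      simp only [hsdef]
      rw [div_le_iff₀ hNp]
      nlinarith
    rw [bm_step hB s hs h0 D hD m t hmt _ (FL_measurable β t) hFint]
    have hneg : ∫ ω in gridSet B s D m \ gridSet B s D (m + 1),
        (∫ w, FL β t (B (s m) ω + w) ∂(gaussianReal 0 (Real.toNNReal (t - s m)))) ∂P ≤ 0 := by
      refine setIntegral_nonpos ((gridSet_measurable hB s D hD _).diff
        (gridSet_measurable hB s D hD _)) ?_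
      rintro ω ⟨h1, h2⟩
      refine FL_outside β t (s m) _ ht hβ (h0 ▸ hs (Nat.zero_le m)) hmt ?_
      by_contra hc
      push Not at hc
      apply h2
      intro j hj
      rcases Nat.lt_succ_iff_lt_or_eq.mp hj with h | h
      · exact h1 j h
      · subst h; exact hc
    have := ih (by omega)
    linarith

/-- The grid approximation of the good event. -/
def goodGrid (B : ℝ → Ω → ℝ) (t β : ℝ) (N : ℕ) : Set Ω :=
  gridSet B (fun j => j * t / N) (fun j => {x | |x| ≤ 3 / 4 + β * (j * t / N)}) (N + 1) ∩
    {ω | B t ω - β * t ∈ Set.Icc (-(1 / 4) : ℝ) 0}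

lemma goodGrid_measurable (hB : IsStandardBrownianMotion P B) (t β : ℝ) (N : ℕ) :
    MeasurableSet (goodGrid B t β N) := by
  refine (gridSet_measurable hB _ _ (fun j => measurableSet_le measurable_id.abs
    measurable_const) _).inter ?_
  exact ((hB.measurable t).sub measurable_const) measurableSet_Icc

lemma goodGrid_lower (hB : IsStandardBrownianMotion P B) (t β : ℝ) (ht : 1 ≤ t) (hβ : 1 ≤ β)
    (N : ℕ) (hN : 0 < N) : uL β t / 4 ≤ P.real (goodGrid B t β N) := by
  have := hB.isProbabilityMeasure
  refine (lower_grid hB t β ht hβ N hN (N + 1) le_rfl).trans ?_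
  set G := gridSet B (fun j => j * t / N) (fun j => {x | |x| ≤ 3 / 4 + β * (j * t / N)}) (N + 1)
    with hG
  have hGm : MeasurableSet G := gridSet_measurable hB _ _
    (fun j => measurableSet_le measurable_id.abs measurable_const) _
  set J : Set Ω := {ω | B t ω - β * t ∈ Set.Icc (-(1 / 4) : ℝ) 0} with hJ
  have hJm : MeasurableSet J := ((hB.measurable t).sub measurable_const) measurableSet_Icc
  have hFint := FL_integrable hB t β (by linarith) (by linarith)
  have h1 : ∫ ω in G, FL β t (B t ω) ∂P ≤ ∫ ω in G, J.indicator (fun _ => (1 : ℝ)) ω ∂P := by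
    refine setIntegral_mono hFint.integrableOn ?_ ?_
    · exact ((integrable_const (1 : ℝ)).indicator hJm).integrableOn
    · intro ω
      exact FL_le β t (B t ω) ht hβ
  refine h1.trans (le_of_eq ?_)
  rw [setIntegral_indicator hJm, setIntegral_const, smul_eq_mul, mul_one]
  rfl

lemma goodGrid_indep (hB : IsStandardBrownianMotion P B) (t β : ℝ) (ht : 1 ≤ t)
    (N : ℕ) (hN : 0 < N) : P (goodGrid B t β N ∩ {ω | 6 ≤ B (t + 1) ω - B t ω}) =
      P (goodGrid B t β N) * gaussianReal 0 1 (Set.Ici 6) := by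
  have hNp : (0 : ℝ) < N := by exact_mod_cast hN
  set s : ℕ → ℝ := fun j => j * t / N with hsdef
  have hs : Monotone s := by
    intro i j hij
    have : (i : ℝ) ≤ j := by exact_mod_cast hij
    simp only [hsdef]
    gcongr
  have h0 : s 0 = 0 := by simp [hsdef]
  have hsN : s N = t := by simp only [hsdef]; field_simp
  have hind := bm_indep_grid hB s hs h0 N (t + 1) (by rw [hsN]; linarith)
  rw [hsN] at hind
  let S : Set (Fin (N + 1) → ℝ) := {x | (∀ j : Fin (N + 1), |x j| ≤ 3 / 4 + β * s j) ∧
    x (Fin.last N) - β * t ∈ Set.Icc (-(1 / 4) : ℝ) 0}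
  have hS : MeasurableSet S := by
    have : S = (⋂ j : Fin (N + 1), {x | |x j| ≤ 3 / 4 + β * s j}) ∩
        {x | x (Fin.last N) - β * t ∈ Set.Icc (-(1 / 4) : ℝ) 0} := by
      ext x; simp [S]
    rw [this]
    refine (MeasurableSet.iInter fun j => ?_).inter ?_
    · exact measurableSet_le (measurable_pi_apply j).abs measurable_const
    · exact ((measurable_pi_apply (Fin.last N)).sub measurable_const) measurableSet_Icc
  have e1 : goodGrid B t β N = (fun ω (j : Fin (N + 1)) => B (s j) ω) ⁻¹' S := by
    ext ω
    constructor
    · rintro ⟨h1, h2⟩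
      refine ⟨fun j => h1 j j.2, ?_⟩
      simp only [Fin.val_last, hsN]
      exact h2
    · rintro ⟨h1, h2⟩
      simp only [Fin.val_last, hsN] at h2
      exact ⟨fun j hj => h1 ⟨j, hj⟩, h2⟩
  have e2 : {ω | 6 ≤ B (t + 1) ω - B t ω} = (fun ω => B (t + 1) ω - B t ω) ⁻¹' Set.Ici 6 := rfl
  have e3 : P ((fun ω => B (t + 1) ω - B t ω) ⁻¹' Set.Ici 6) = gaussianReal 0 1 (Set.Ici 6) := by
    have := hB.gaussian_increments t (t + 1) (by linarith) (by linarith)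
    rw [add_sub_cancel_left, Real.toNNReal_one] at this
    rw [← this]
    exact (Measure.map_apply ((hB.measurable _).sub (hB.measurable _)) measurableSet_Ici).symm
  rw [e1, e2, hind.measure_inter_preimage_eq_mul _ _ hS measurableSet_Ici, e3]

lemma goodGrid_antitone (t β : ℝ) : Antitone fun n : ℕ => goodGrid B t β (2 ^ n) := by
  refine antitone_nat_of_succ_le fun n => ?_
  rintro ω ⟨h1, h2⟩
  refine ⟨fun j hj => ?_, h2⟩
  have h := h1 (2 * j) (by rw [pow_succ]; omega)
  have e : ((2 * j : ℕ) : ℝ) * t / ((2 ^ (n + 1) : ℕ) : ℝ) = j * t / ((2 ^ n : ℕ) : ℝ) := by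
    push_cast
    rw [pow_succ]
    field_simp
  simp only [e] at h
  exact h

lemma goodGrid_path (t β : ℝ) (ht : 1 ≤ t) (ω : Ω) (hc : Continuous fun s => B s ω)
    (h : ∀ n : ℕ, ω ∈ goodGrid B t β (2 ^ n)) (s : ℝ) (hs : 0 ≤ s) (hst : s ≤ t) :
    |B s ω| ≤ 3 / 4 + β * s := by
  have ht0 : 0 < t := by linarith
  have hlim0 : Filter.Tendsto (fun n : ℕ => (⌊s / t * (2 : ℝ) ^ n⌋₊ : ℝ) / (2 : ℝ) ^ n)
      Filter.atTop (nhds (s / t)) :=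
    (tendsto_nat_floor_mul_div_atTop (R := ℝ) (div_nonneg hs ht0.le)).comp
      (tendsto_pow_atTop_atTop_of_one_lt one_lt_two)
  have hlim : Filter.Tendsto (fun n : ℕ => (⌊s / t * (2 : ℝ) ^ n⌋₊ : ℝ) * t / ((2 ^ n : ℕ) : ℝ))
      Filter.atTop (nhds s) := by
    have := hlim0.mul_const t
    rw [div_mul_cancel₀ _ ht0.ne'] at this
    refine this.congr fun n => ?_
    push_cast
    ring
  refine le_of_tendsto_of_tendsto (f := fun n : ℕ =>
    |B ((⌊s / t * (2 : ℝ) ^ n⌋₊ : ℝ) * t / ((2 ^ n : ℕ) : ℝ)) ω|)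
    (g := fun n : ℕ => 3 / 4 + β * ((⌊s / t * (2 : ℝ) ^ n⌋₊ : ℝ) * t / ((2 ^ n : ℕ) : ℝ)))
    ?_ ?_ ?_ (b := Filter.atTop)
  · exact ((hc.tendsto s).comp hlim).abs
  · exact (hlim.const_mul β).const_add _
  · refine Filter.Eventually.of_forall fun n => ?_
    refine (h n).1 _ ?_
    rw [Nat.lt_succ_iff]
    apply Nat.floor_le_of_le
    push_cast
    have : s / t ≤ 1 := by rw [div_le_one ht0]; exact hst
    have h2 : (0 : ℝ) < 2 ^ n := by positivity
    nlinarith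

lemma lower_prob (hB : IsStandardBrownianMotion P B) (t β : ℝ) (ht : 1 ≤ t) (hβ : 1 ≤ β) :
    ENNReal.ofReal ((√(2 * π))⁻¹ * rexp (-1) / 32 * (gaussianReal 0 1).real (Set.Ici 6) *
      ((t * √t)⁻¹ * rexp (-(β ^ 2 * t / 2)))) ≤
    P {ω | (∀ s, 0 ≤ s → s ≤ t → |B s ω| ≤ 3 / 4 + β * s) ∧
      B t ω - β * t ∈ Set.Icc (-(1 / 4) : ℝ) 0 ∧ 6 ≤ B (t + 1) ω - B t ω} := by
  have := hB.isProbabilityMeasure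
  set p := (gaussianReal 0 1).real (Set.Ici 6) with hp
  set H : Set Ω := {ω | 6 ≤ B (t + 1) ω - B t ω} with hH
  have hHm : MeasurableSet H :=
    measurableSet_le measurable_const ((hB.measurable _).sub (hB.measurable _))
  set A : ℕ → Set Ω := fun n => goodGrid B t β (2 ^ n) ∩ H with hA
  have hAm : ∀ n, MeasurableSet (A n) := fun n => (goodGrid_measurable hB t β _).inter hHm
  have hAanti : Antitone A := fun i j hij =>
    Set.inter_subset_inter_left _ (goodGrid_antitone t β hij)
  have hlim := tendsto_measure_iInter_atTop (μ := P) (fun n => (hAm n).nullMeasurableSet) hAanti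
    ⟨0, measure_ne_top P _⟩
  have hp0 : 0 ≤ p := measureReal_nonneg
  have hlow : ∀ n, ENNReal.ofReal ((√(2 * π))⁻¹ * rexp (-1) / 32 * p *
      ((t * √t)⁻¹ * rexp (-(β ^ 2 * t / 2)))) ≤ P (A n) := by
    intro n
    have h1 := goodGrid_lower hB t β ht hβ (2 ^ n) (by positivity)
    have h2 := uL_lower t β ht hβ
    rw [hA]
    simp only [hH]
    rw [goodGrid_indep hB t β ht (2 ^ n) (by positivity)]
    rw [← ofReal_measureReal (μ := P), ← ofReal_measureReal (μ := gaussianReal 0 1),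
      ← ENNReal.ofReal_mul measureReal_nonneg]
    apply ENNReal.ofReal_le_ofReal
    rw [← hp]
    have h3 : (√(2 * π))⁻¹ * rexp (-1) / 32 * ((t * √t)⁻¹ * rexp (-(β ^ 2 * t / 2))) ≤
        P.real (goodGrid B t β (2 ^ n)) := by linarith
    have := mul_le_mul_of_nonneg_right h3 hp0
    linarith
  have h4 := ge_of_tendsto' hlim hlow
  refine h4.trans (measure_mono_ae ?_)
  filter_upwards [hB.cont] with ω hω hmem
  have hmem' : ∀ n, ω ∈ A n := Set.mem_iInter.mp hmem
  exact ⟨goodGrid_path t β ht ω hω fun n => (hmem' n).1, (hmem' 0).1.2, (hmem' 0).2⟩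

end LowerProb

section Assembly

lemma beta_bounds (t y β : ℝ) (ht : 1 ≤ t) (hy : y ∈ Set.Icc 0 (√t))
    (hβ : β = √2 - (3 / (2 * √2)) * Real.log t / t + y / t) : 1 ≤ β ∧ β ≤ 3 := by
  have ht0 : 0 < t := by linarith
  have h2 : √2 * √2 = 2 := Real.mul_self_sqrt (by norm_num)
  have h2p : 0 < √2 := by positivity
  have h2a : (1.414 : ℝ) ≤ √2 := Real.le_sqrt_of_sq_le (by norm_num)
  have h2b : √2 ≤ 1.5 := by rw [Real.sqrt_le_left (by norm_num)]; norm_num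
  have hκ : 3 / (2 * √2) = 3 / 4 * √2 := by
    rw [div_eq_iff (by positivity)]; linarith
  have hL0 : 0 ≤ Real.log t / t := div_nonneg (Real.log_nonneg ht) ht0.le
  have hL1 : Real.log t / t ≤ 0.37 := by
    rw [div_le_iff₀ ht0]
    have h := Real.log_le_sub_one_of_pos (x := t / rexp 1) (by positivity)
    rw [Real.log_div ht0.ne' (Real.exp_pos 1).ne', Real.log_exp] at h
    have he := Real.exp_one_gt_d9
    have h3 : t / rexp 1 ≤ 0.37 * t := by
      rw [div_le_iff₀ (Real.exp_pos 1)]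
      nlinarith
    linarith
  have hy0 : 0 ≤ y / t := div_nonneg hy.1 ht0.le
  have hy1 : y / t ≤ 1 := by
    rw [div_le_one ht0]
    refine hy.2.trans ?_
    rw [Real.sqrt_le_left (by linarith)]
    nlinarith
  rw [hκ, mul_div_assoc] at hβ
  constructor
  · have : √2 * (Real.log t / t) ≤ √2 * 0.37 := mul_le_mul_of_nonneg_left hL1 h2p.le
    nlinarith
  · have : 0 ≤ √2 * (Real.log t / t) := mul_nonneg h2p.le hL0
    nlinarith

lemma exponent_bounds (t y β : ℝ) (ht : 1 ≤ t) (hy : y ∈ Set.Icc 0 (√t))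
    (hβ : β = √2 - (3 / (2 * √2)) * Real.log t / t + y / t) :
    rexp (-6) * (rexp (-t) * rexp (-√2 * y)) ≤ (t * √t)⁻¹ * rexp (-(β ^ 2 * t / 2)) ∧
    (t * √t)⁻¹ * rexp (-(β ^ 2 * t / 2)) ≤ rexp (-t) * rexp (-√2 * y) := by
  have ht0 : 0 < t := by linarith
  have h2 : √2 * √2 = 2 := Real.mul_self_sqrt (by norm_num)
  have h2p : 0 < √2 := by positivity
  have hκ : 3 / (2 * √2) = 3 / 4 * √2 := by
    rw [div_eq_iff (by positivity)]; linarith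
  set L := Real.log t with hL
  have hst : √t * √t = t := Real.mul_self_sqrt ht0.le
  have hL0 : 0 ≤ L := Real.log_nonneg ht
  have hL1 : L ≤ 2 * √t := by
    have h := Real.log_le_sub_one_of_pos (x := √t) (by positivity)
    rw [Real.log_sqrt ht0.le] at h
    linarith
  have hT : (t * √t)⁻¹ = rexp (-(3 / 2 * L)) := by
    rw [Real.exp_neg]
    congr 1
    have e1 : rexp L = t := Real.exp_log ht0
    have e2 : √t = rexp (L / 2) := by rw [Real.exp_half, e1]
    rw [e2]
    nth_rewrite 1 [← e1]
    rw [← Real.exp_add]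
    congr 1; ring
  set q := y - 3 / 4 * √2 * L with hq
  have hβ' : β = √2 + q / t := by
    rw [hβ, hκ, hq]; field_simp; ring
  have hexp : β ^ 2 * t / 2 = t + √2 * y - 3 / 2 * L + q ^ 2 / (2 * t) := by
    have : β ^ 2 * t / 2 = (√2 * √2) / 2 * t + √2 * q + q ^ 2 / (2 * t) := by
      rw [hβ']; field_simp; ring
    rw [this, h2]
    have : √2 * q = √2 * y - 3 / 4 * (√2 * √2) * L := by rw [hq]; ring
    rw [this, h2]; ring
  have hq0 : 0 ≤ q ^ 2 / (2 * t) := by positivity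
  have hq1 : q ^ 2 / (2 * t) ≤ 6 := by
    rw [div_le_iff₀ (by positivity)]
    have hy2 : y * y ≤ t := by rw [← hst]; exact mul_self_le_mul_self hy.1 hy.2
    have hL2 : L * L ≤ 4 * t := by
      have := mul_self_le_mul_self hL0 hL1
      nlinarith
    have h5 : q ^ 2 ≤ 2 * (y * y) + 9 / 8 * (√2 * √2) * (L * L) := by
      rw [hq]
      nlinarith [sq_nonneg (y + 3 / 4 * √2 * L)]
    rw [h2] at h5
    linarith
  have key : (t * √t)⁻¹ * rexp (-(β ^ 2 * t / 2)) =
      rexp (-(q ^ 2 / (2 * t))) * (rexp (-t) * rexp (-√2 * y)) := by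
    rw [hT, hexp, ← Real.exp_add, ← Real.exp_add, ← Real.exp_add]
    congr 1; ring
  rw [key]
  constructor
  · apply mul_le_mul_of_nonneg_right _ (by positivity)
    rw [Real.exp_le_exp]; linarith
  · apply mul_le_of_le_one_left (by positivity)
    rw [Real.exp_le_one_iff]; linarith

lemma gaussian_tail_pos : 0 < (gaussianReal 0 1).real (Set.Ici 6) := by
  have h : gaussianReal 0 1 (Set.Ici (6 : ℝ)) ≠ 0 := by
    intro h
    have h1 := gaussianReal_absolutelyContinuous' 0 (v := 1) one_ne_zero h
    simp at h1
  exact ENNReal.toReal_pos h (measure_ne_top _ _)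

end Assembly

/-- Two-sided bound on the probability that a reflected Brownian motion stays below the
barrier `s ↦ 1 + β s` up to time `t` and ends in `[βt − 1, βt]`, where
`β = √2 − (3/(2√2))·(log t)/t + y/t`.  By the many-to-one principle this gives the
two-sided bound `c₁ e^{−√2 y} ≤ 𝔼 H^R(y,t) ≤ C₁ e^{−√2 y}`. -/
theorem expected_barrier_particles_bound {Ω : Type*} [MeasurableSpace Ω] (P : Measure Ω)
    (B : ℝ → Ω → ℝ) (hB : IsStandardBrownianMotion P B) :
    ∃ c₁ C₁ : ℝ, 0 < c₁ ∧ 0 < C₁ ∧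
      ∀ t y : ℝ, 1 ≤ t → y ∈ Set.Icc 0 (Real.sqrt t) →
        ∀ β : ℝ, β = Real.sqrt 2 - (3 / (2 * Real.sqrt 2)) * Real.log t / t + y / t →
        ∀ τ : Ω → ℝ, (∀ ω, τ ω = sInf {s : ℝ | 0 ≤ s ∧ 1 + β * s ≤ |B s ω|}) →
          ENNReal.ofReal (c₁ * Real.exp (-t) * Real.exp (-Real.sqrt 2 * y)) ≤
              P {ω | t ≤ τ ω ∧ |B t ω| ∈ Set.Icc (β * t - 1) (β * t)} ∧
            P {ω | t ≤ τ ω ∧ |B t ω| ∈ Set.Icc (β * t - 1) (β * t)} ≤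
              ENNReal.ofReal (C₁ * Real.exp (-t) * Real.exp (-Real.sqrt 2 * y)) := by
  have := hB.isProbabilityMeasure
  have hp := gaussian_tail_pos
  have hg := gp_pos one_pos 4
  have hg' : 0 < 4 / gp 1 4 := by positivity
  set c := (√(2 * π))⁻¹ * rexp (-1) / 32 * (gaussianReal 0 1).real (Set.Ici 6) with hc
  have hc0 : 0 < c := by positivity
  refine ⟨c * rexp (-6), 2 * (4 / gp 1 4), by positivity, by positivity, ?_⟩
  intro t y ht hy β hβ τ hτ
  obtain ⟨hβ1, hβ3⟩ := beta_bounds t y β ht hy hβ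
  obtain ⟨hlo, hhi⟩ := exponent_bounds t y β ht hy hβ
  constructor
  · refine le_trans ?_ ((lower_prob hB t β ht hβ1).trans (measure_mono ?_))
    · apply ENNReal.ofReal_le_ofReal
      have := mul_le_mul_of_nonneg_left hlo hc0.le
      refine le_trans (le_of_eq ?_) this
      ring
    · rintro ω ⟨h1, h2, h3⟩
      have hβt : 1 ≤ β * t := one_le_mul_of_one_le_of_one_le hβ1 ht
      have h21 := h2.1
      have h22 := h2.2
      refine ⟨?_, ?_⟩
      · rw [hτ ω]
        apply le_csInf
        · refine ⟨t + 1, by linarith, ?_⟩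
          refine le_trans ?_ (le_abs_self _)
          rw [mul_add]
          linarith
        · rintro s ⟨hs0, hs1⟩
          by_contra hlt
          push Not at hlt
          have := h1 s hs0 hlt.le
          linarith
      · rw [abs_of_nonneg (by linarith)]
        constructor <;> linarith
  · have hu1 := upper_prob hB t β ht hβ1 hβ3
    have hu2 := upper_prob (bm_neg hB) t β ht hβ1 hβ3
    set E1 := {ω | (∀ s, 0 ≤ s → s < t → B s ω < 1 + β * s) ∧
      B t ω ∈ Set.Icc (β * t - 1) (β * t)}
    set E2 := {ω | (∀ s, 0 ≤ s → s < t → - B s ω < 1 + β * s) ∧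
      - B t ω ∈ Set.Icc (β * t - 1) (β * t)}
    have hsub : {ω | t ≤ τ ω ∧ |B t ω| ∈ Set.Icc (β * t - 1) (β * t)} ⊆ E1 ∪ E2 := by
      rintro ω ⟨h1, h2⟩
      have hbar : ∀ s, 0 ≤ s → s < t → |B s ω| < 1 + β * s := by
        intro s hs0 hst
        by_contra hc
        push Not at hc
        have : τ ω ≤ s := by
          rw [hτ ω]
          exact csInf_le ⟨0, fun x hx => hx.1⟩ ⟨hs0, hc⟩
        linarith
      rcases le_total 0 (B t ω) with h | h
      · left
        rw [abs_of_nonneg h] at h2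
        exact ⟨fun s hs0 hst => (le_abs_self _).trans_lt (hbar s hs0 hst), h2⟩
      · right
        rw [abs_of_nonpos h] at h2
        exact ⟨fun s hs0 hst => (neg_le_abs _).trans_lt (hbar s hs0 hst), h2⟩
    rw [← ofReal_measureReal (μ := P)]
    apply ENNReal.ofReal_le_ofReal
    have h1 := (measureReal_mono (μ := P) hsub).trans (measureReal_union_le E1 E2)
    have h2 := mul_le_mul_of_nonneg_left hhi hg'.le
    linarith
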